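/- arXiv:1405.7546 — 2 statements merged into one kernel-verified Lean document; each statement's English description precedes it below -/
import Mathlib

section
/- Let n ≥ 2 be even and let m ≥ n+2. The polynomial f^{(5)}_{m,n+2} = Σ_{σ ∈ S_{n+2}} sgn(σ) [x_{σ(1)},x_{σ(2)},x₁,…,x₁][x_{σ(3)},x_{σ(4)}]⋯[x_{σ(n+1)},x_{σ(n+2)}], where the first left-normed commutator has m−n−2 occurrences of x₁ after x_{σ(2)} and the sum runs over all permutations σ of {1,…,n+2}, is not a polynomial identity of the relatively free algebra F_n(A). -/
noncomputable section

/-- `f ∈ K⟨X⟩` (with set of variables `X`) is a polynomial identity of the `K`-algebra `R`: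
every substitution of elements of `R` for the variables (i.e. every `K`-algebra homomorphism
from the free algebra to `R`) kills `f`. -/
def IsPI (K : Type) [Field K] {X : Type} (R : Type) [Ring R] [Algebra K R]
    (f : FreeAlgebra K X) : Prop :=
  ∀ φ : FreeAlgebra K X →ₐ[K] R, φ f = 0

/-- `T(R)`: the set of polynomial identities of `R` inside `K⟨x₁, x₂, …⟩`
(the free unital associative algebra on countably many variables, indexed by `ℕ`). -/
def TId (K : Type) [Field K] (R : Type) [Ring R] [Algebra K R] : Set (FreeAlgebra K ℕ) :=
  {f | IsPI K R f}

/-- A two-sided ideal of `K⟨X⟩` is a T-ideal when it is invariant under all algebra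
endomorphisms of `K⟨X⟩`. -/
def IsTIdeal (K : Type) [Field K] (I : TwoSidedIdeal (FreeAlgebra K ℕ)) : Prop :=
  ∀ φ : FreeAlgebra K ℕ →ₐ[K] FreeAlgebra K ℕ, ∀ f ∈ I, φ f ∈ I

/-- `⟨F⟩^T`: the smallest T-ideal of `K⟨X⟩` containing the set `F`. -/
def TIdealGen (K : Type) [Field K] (F : Set (FreeAlgebra K ℕ)) : Set (FreeAlgebra K ℕ) :=
  {g | ∀ I : TwoSidedIdeal (FreeAlgebra K ℕ), IsTIdeal K I → F ⊆ (I : Set (FreeAlgebra K ℕ)) → g ∈ I}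

/-- The commutator `[a, b] = a * b - b * a`. -/
def br {R : Type} [Ring R] (a b : R) : R := a * b - b * a

/-- The left-normed commutator `[a, b, b, …, b]` with `k` occurrences of `b`. -/
def commPow {R : Type} [Ring R] (a b : R) (k : ℕ) : R := (fun y => br y b)^[k] a

/-- The variable `xᵢ` of `K⟨x₁, x₂, …⟩` (1-based indexing). -/
def xv (K : Type) [Field K] (i : ℕ) : FreeAlgebra K ℕ := FreeAlgebra.ι K i

/-- The product of commutators `[x₁,x₂][x₃,x₄]⋯[x_{2k-1},x_{2k}]`. -/
def chainProd (K : Type) [Field K] (k : ℕ) : FreeAlgebra K ℕ :=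
  ((List.range k).map fun i => br (xv K (2 * i + 1)) (xv K (2 * i + 2))).prod

/-- The Grassmann (exterior) algebra of an infinite dimensional `K`-vector space
with basis `e₁, e₂, …`. -/
abbrev Einf (K : Type) [Field K] : Type := ExteriorAlgebra K (ℕ →₀ K)

/-- The Grassmann (exterior) algebra `E⁽ⁿ⁾` of an `n`-dimensional `K`-vector space. -/
abbrev Efin (K : Type) [Field K] (n : ℕ) : Type := ExteriorAlgebra K (Fin n → K)

/-- The even part `E₀` of the Grassmann algebra of `V`. -/
def evenPart (K V : Type) [Field K] [AddCommGroup V] [Module K V] :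
    Submodule K (ExteriorAlgebra K V) :=
  CliffordAlgebra.evenOdd (0 : QuadraticForm K V) 0

/-- The odd part `E₁` of the Grassmann algebra of `V`. -/
def oddPart (K V : Type) [Field K] [AddCommGroup V] [Module K V] :
    Submodule K (ExteriorAlgebra K V) :=
  CliffordAlgebra.evenOdd (0 : QuadraticForm K V) 1

section matrixAlgebras

variable (K V : Type) [Field K] [AddCommGroup V] [Module K V]

private theorem evenPart_mul_mem {a b : ExteriorAlgebra K V}
    (ha : a ∈ evenPart K V) (hb : b ∈ evenPart K V) : a * b ∈ evenPart K V := by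
  have := CliffordAlgebra.evenOdd_mul_le (Q := (0 : QuadraticForm K V)) 0 0
    (Submodule.mul_mem_mul ha hb)
  simpa [evenPart] using this

private theorem evenPart_one_mem : (1 : ExteriorAlgebra K V) ∈ evenPart K V :=
  SetLike.one_mem_graded _

private theorem evenPart_algebraMap_mem (c : K) :
    algebraMap K (ExteriorAlgebra K V) c ∈ evenPart K V :=
  SetLike.algebraMap_mem_graded _ c

/-- The algebra `A` (over the Grassmann algebra of `V`): the subalgebra of `2 × 2`
matrices over `E = Λ(V)` whose `(1,1)` entry lies in `E₀`, whose `(2,1)` entry is `0`,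
and whose `(1,2)` and `(2,2)` entries are arbitrary. -/
def algA : Subalgebra K (Matrix (Fin 2) (Fin 2) (ExteriorAlgebra K V)) where
  carrier := {M | M 0 0 ∈ evenPart K V ∧ M 1 0 = 0}
  mul_mem' := by
    rintro a b ⟨ha0, ha1⟩ ⟨hb0, hb1⟩
    refine ⟨?_, ?_⟩
    · have h : (a * b) 0 0 = a 0 0 * b 0 0 + a 0 1 * b 1 0 := by
        simp [Matrix.mul_apply, Fin.sum_univ_two]
      rw [h, hb1, mul_zero, add_zero]
      exact evenPart_mul_mem K V ha0 hb0
    · have h : (a * b) 1 0 = a 1 0 * b 0 0 + a 1 1 * b 1 0 := by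
        simp [Matrix.mul_apply, Fin.sum_univ_two]
      rw [h, ha1, hb1, zero_mul, mul_zero, add_zero]
  one_mem' := by
    refine ⟨?_, ?_⟩
    · rw [Matrix.one_apply_eq]; exact evenPart_one_mem K V
    · exact Matrix.one_apply_ne (by decide)
  add_mem' := by
    rintro a b ⟨ha0, ha1⟩ ⟨hb0, hb1⟩
    exact ⟨Submodule.add_mem _ ha0 hb0, by simp [ha1, hb1]⟩
  zero_mem' := ⟨Submodule.zero_mem _, rfl⟩
  algebraMap_mem' := fun c => by
    refine ⟨?_, ?_⟩
    · rw [Matrix.algebraMap_matrix_apply, if_pos rfl]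
      exact evenPart_algebraMap_mem K V c
    · rw [Matrix.algebraMap_matrix_apply, if_neg (by decide)]

end matrixAlgebras

section matrixAlgebras2

variable (K V : Type) [Field K] [AddCommGroup V] [Module K V]

private theorem oddPart_mul_mem_even {a b : ExteriorAlgebra K V}
    (ha : a ∈ oddPart K V) (hb : b ∈ oddPart K V) : a * b ∈ evenPart K V := by
  have := CliffordAlgebra.evenOdd_mul_le (Q := (0 : QuadraticForm K V)) 1 1
    (Submodule.mul_mem_mul ha hb)
  have h2 : ((1 : ZMod 2) + 1) = 0 := by decide
  rw [h2] at this
  exact this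

private theorem even_mul_odd_mem {a b : ExteriorAlgebra K V}
    (ha : a ∈ evenPart K V) (hb : b ∈ oddPart K V) : a * b ∈ oddPart K V := by
  have := CliffordAlgebra.evenOdd_mul_le (Q := (0 : QuadraticForm K V)) 0 1
    (Submodule.mul_mem_mul ha hb)
  rw [zero_add] at this
  exact this

private theorem odd_mul_even_mem {a b : ExteriorAlgebra K V}
    (ha : a ∈ oddPart K V) (hb : b ∈ evenPart K V) : a * b ∈ oddPart K V := by
  have := CliffordAlgebra.evenOdd_mul_le (Q := (0 : QuadraticForm K V)) 1 0
    (Submodule.mul_mem_mul ha hb)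
  rw [add_zero] at this
  exact this

/-- The algebra `A′` (over the Grassmann algebra of `V`): the subalgebra of `2 × 2`
matrices over `E = Λ(V)` whose `(2,2)` entry lies in `E₀`, whose `(2,1)` entry is `0`,
and whose `(1,1)` and `(1,2)` entries are arbitrary. -/
def algA' : Subalgebra K (Matrix (Fin 2) (Fin 2) (ExteriorAlgebra K V)) where
  carrier := {M | M 1 1 ∈ evenPart K V ∧ M 1 0 = 0}
  mul_mem' := by
    rintro a b ⟨ha0, ha1⟩ ⟨hb0, hb1⟩
    refine ⟨?_, ?_⟩
    · have h : (a * b) 1 1 = a 1 0 * b 0 1 + a 1 1 * b 1 1 := by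
        simp [Matrix.mul_apply, Fin.sum_univ_two]
      rw [h, ha1, zero_mul, zero_add]
      exact evenPart_mul_mem K V ha0 hb0
    · have h : (a * b) 1 0 = a 1 0 * b 0 0 + a 1 1 * b 1 0 := by
        simp [Matrix.mul_apply, Fin.sum_univ_two]
      rw [h, ha1, hb1, zero_mul, mul_zero, add_zero]
  one_mem' := by
    refine ⟨?_, ?_⟩
    · rw [Matrix.one_apply_eq]; exact evenPart_one_mem K V
    · exact Matrix.one_apply_ne (by decide)
  add_mem' := by
    rintro a b ⟨ha0, ha1⟩ ⟨hb0, hb1⟩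
    exact ⟨Submodule.add_mem _ ha0 hb0, by simp [ha1, hb1]⟩
  zero_mem' := ⟨Submodule.zero_mem _, rfl⟩
  algebraMap_mem' := fun c => by
    refine ⟨?_, ?_⟩
    · rw [Matrix.algebraMap_matrix_apply, if_pos rfl]
      exact evenPart_algebraMap_mem K V c
    · rw [Matrix.algebraMap_matrix_apply, if_neg (by decide)]

/-- The algebra `M_{1,1}` (over the Grassmann algebra of `V`): the subalgebra of `2 × 2`
matrices over `E = Λ(V)` whose diagonal entries lie in `E₀` and whose off-diagonal entries
lie in `E₁`. -/
def m11 : Subalgebra K (Matrix (Fin 2) (Fin 2) (ExteriorAlgebra K V)) where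
  carrier := {M | M 0 0 ∈ evenPart K V ∧ M 1 1 ∈ evenPart K V ∧
    M 0 1 ∈ oddPart K V ∧ M 1 0 ∈ oddPart K V}
  mul_mem' := by
    rintro a b ⟨ha00, ha11, ha01, ha10⟩ ⟨hb00, hb11, hb01, hb10⟩
    have h00 : (a * b) 0 0 = a 0 0 * b 0 0 + a 0 1 * b 1 0 := by
      simp [Matrix.mul_apply, Fin.sum_univ_two]
    have h11 : (a * b) 1 1 = a 1 0 * b 0 1 + a 1 1 * b 1 1 := by
      simp [Matrix.mul_apply, Fin.sum_univ_two]
    have h01 : (a * b) 0 1 = a 0 0 * b 0 1 + a 0 1 * b 1 1 := by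
      simp [Matrix.mul_apply, Fin.sum_univ_two]
    have h10 : (a * b) 1 0 = a 1 0 * b 0 0 + a 1 1 * b 1 0 := by
      simp [Matrix.mul_apply, Fin.sum_univ_two]
    refine ⟨?_, ?_, ?_, ?_⟩
    · rw [h00]
      exact Submodule.add_mem _ (evenPart_mul_mem K V ha00 hb00)
        (oddPart_mul_mem_even K V ha01 hb10)
    · rw [h11]
      exact Submodule.add_mem _ (oddPart_mul_mem_even K V ha10 hb01)
        (evenPart_mul_mem K V ha11 hb11)
    · rw [h01]
      exact Submodule.add_mem _ (even_mul_odd_mem K V ha00 hb01)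
        (odd_mul_even_mem K V ha01 hb11)
    · rw [h10]
      exact Submodule.add_mem _ (odd_mul_even_mem K V ha10 hb00)
        (even_mul_odd_mem K V ha11 hb10)
  one_mem' := by
    refine ⟨?_, ?_, ?_, ?_⟩
    · rw [Matrix.one_apply_eq]; exact evenPart_one_mem K V
    · rw [Matrix.one_apply_eq]; exact evenPart_one_mem K V
    · rw [Matrix.one_apply_ne (by decide)]; exact Submodule.zero_mem _
    · rw [Matrix.one_apply_ne (by decide)]; exact Submodule.zero_mem _
  add_mem' := by
    rintro a b ⟨ha00, ha11, ha01, ha10⟩ ⟨hb00, hb11, hb01, hb10⟩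
    exact ⟨Submodule.add_mem _ ha00 hb00, Submodule.add_mem _ ha11 hb11,
      Submodule.add_mem _ ha01 hb01, Submodule.add_mem _ ha10 hb10⟩
  zero_mem' := ⟨Submodule.zero_mem _, Submodule.zero_mem _,
    Submodule.zero_mem _, Submodule.zero_mem _⟩
  algebraMap_mem' := fun c => by
    refine ⟨?_, ?_, ?_, ?_⟩
    · rw [Matrix.algebraMap_matrix_apply, if_pos rfl]
      exact evenPart_algebraMap_mem K V c
    · rw [Matrix.algebraMap_matrix_apply, if_pos rfl]
      exact evenPart_algebraMap_mem K V c
    · rw [Matrix.algebraMap_matrix_apply, if_neg (by decide)]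
      exact Submodule.zero_mem _
    · rw [Matrix.algebraMap_matrix_apply, if_neg (by decide)]
      exact Submodule.zero_mem _

end matrixAlgebras2

/-- The relatively free algebra `F_n(R) = K⟨x₁, …, xₙ⟩ / (K⟨x₁, …, xₙ⟩ ∩ T(R))` of rank `n`
of the variety generated by `R`: the quotient of the free algebra on `n` variables by the
ideal of polynomial identities of `R` in those variables. -/
abbrev RelFree (K : Type) [Field K] (R : Type) [Ring R] [Algebra K R] (n : ℕ) : Type :=
  RingQuot (fun f g : FreeAlgebra K (Fin n) => IsPI K R (f - g))

end

/-- The generator `e_j` of the infinite dimensional Grassmann algebra. -/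
noncomputable def gen (K : Type) [Field K] (j : ℕ) : Einf K := ExteriorAlgebra.ι K (Finsupp.single j 1)

theorem gen_mul_self (K : Type) [Field K] (j : ℕ) : gen K j * gen K j = 0 :=
  ExteriorAlgebra.ι_sq_zero _

theorem gen_mul_gen_swap (K : Type) [Field K] (i j : ℕ) :
    gen K i * gen K j = -(gen K j * gen K i) :=
  eq_neg_of_add_eq_zero_left (ExteriorAlgebra.ι_add_mul_swap _ _)

theorem br_gen (K : Type) [Field K] (i j : ℕ) :
    br (gen K i) (gen K j) = 2 * (gen K i * gen K j) := by
  rw [br, gen_mul_gen_swap K j i]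
  noncomm_ring

theorem ιMulti_single_ne_zero (K : Type) [Field K] (N : ℕ) :
    (ExteriorAlgebra.ιMulti K N fun i : Fin N => (Finsupp.single (i : ℕ) 1 : ℕ →₀ K)) ≠ 0 := by
  intro h
  let r : (ℕ →₀ K) →ₗ[K] (Fin N → K) := LinearMap.pi fun i => Finsupp.lapply (i : ℕ)
  let δ : ∀ i, (ℕ →₀ K) [⋀^Fin i]→ₗ[K] K := fun i =>
    if hi : N = i then hi ▸ (Matrix.detRowAlternating (n := Fin N) (R := K)).compLinearMap r else 0
  have h1 := congrArg (ExteriorAlgebra.liftAlternating δ) h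
  rw [ExteriorAlgebra.liftAlternating_apply_ιMulti, map_zero] at h1
  have h2 : (fun i : Fin N => r (Finsupp.single (i : ℕ) 1)) = (1 : Matrix (Fin N) (Fin N) K) := by
    ext i j
    simp [r, Finsupp.single_apply, Matrix.one_apply, Fin.ext_iff]
  have h3 : Matrix.detRowAlternating (fun i : Fin N => r (Finsupp.single (i : ℕ) 1)) = 0 := by
    simpa [δ] using h1
  rw [h2] at h3
  exact one_ne_zero ((Matrix.det_one (n := Fin N) (R := K)).symm.trans h3)

theorem map_br {R S : Type} [Ring R] [Ring S] (f : R →+* S) (a b : R) :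
    f (br a b) = br (f a) (f b) := by
  simp [br]

theorem map_commPow {R S : Type} [Ring R] [Ring S] (f : R →+* S) (a b : R) (k : ℕ) :
    f (commPow a b k) = commPow (f a) (f b) k := by
  induction k with
  | zero => rfl
  | succ k ih =>
    simp only [commPow, Function.iterate_succ_apply'] at ih ⊢
    rw [map_br, ih]

theorem commPow_zero_left {R : Type} [Ring R] (b : R) (k : ℕ) : commPow 0 b k = 0 := by
  induction k with
  | zero => rfl
  | succ k ih =>
    simp only [commPow, Function.iterate_succ_apply'] at ih ⊢
    rw [ih, br, zero_mul, mul_zero, sub_zero]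

theorem commPow_neg {R : Type} [Ring R] (a b : R) (k : ℕ) :
    commPow (-a) b k = -commPow a b k := by
  induction k with
  | zero => rfl
  | succ k ih =>
    simp only [commPow, Function.iterate_succ_apply'] at ih ⊢
    rw [ih, br, br]
    noncomm_ring

section

variable (K V : Type) [Field K] [AddCommGroup V] [Module K V]

/-- The `(1,1)` entry as a ring homomorphism on `A`. -/
noncomputable def entryUL : ↥(algA K V) →+* ExteriorAlgebra K V where
  toFun M := M.1 0 0
  map_one' := by simp
  map_mul' a b := by simp [Matrix.mul_apply, Fin.sum_univ_two, b.2.2]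
  map_zero' := by simp
  map_add' a b := by simp

/-- The `(2,2)` entry as a ring homomorphism on `A`. -/
noncomputable def entryLR : ↥(algA K V) →+* ExteriorAlgebra K V where
  toFun M := M.1 1 1
  map_one' := by simp
  map_mul' a b := by simp [Matrix.mul_apply, Fin.sum_univ_two, a.2.2]
  map_zero' := by simp
  map_add' a b := by simp

/-- The `(1,2)` entry as an additive map on `A`. -/
noncomputable def entryUR : ↥(algA K V) →+ ExteriorAlgebra K V where
  toFun M := M.1 0 1
  map_zero' := by simp
  map_add' a b := by simp

theorem entryUL_apply (M : ↥(algA K V)) : entryUL K V M = M.1 0 0 := rfl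

theorem entryLR_apply (M : ↥(algA K V)) : entryLR K V M = M.1 1 1 := rfl

theorem entryUR_apply (M : ↥(algA K V)) : entryUR K V M = M.1 0 1 := rfl

theorem entryUR_mul (a b : ↥(algA K V)) :
    entryUR K V (a * b) = entryUL K V a * entryUR K V b + entryUR K V a * entryLR K V b := by
  simp [entryUR_apply, entryUL_apply, entryLR_apply, Matrix.mul_apply, Fin.sum_univ_two]

end

section

variable (K : Type) [Field K]

theorem ite_mem_evenPart (p : Prop) [Decidable p] :
    (if p then 1 else 0 : Einf K) ∈ evenPart K (ℕ →₀ K) := by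
  split_ifs
  · exact SetLike.one_mem_graded _
  · exact Submodule.zero_mem _

/-- The matrix with rows `(δ_{j0}, δ_{j1})` and `(0, e_{j+2})`. -/
noncomputable def genMat (j : ℕ) : ↥(algA K (ℕ →₀ K)) :=
  ⟨!![if j = 0 then 1 else 0, if j = 1 then 1 else 0; 0, gen K (j + 2)],
    by simpa using ite_mem_evenPart K (j = 0), by simp⟩

/-- The matrix units `e₁₁`, `e₁₂`, followed by the matrices `genMat`. -/
noncomputable def substMat : ℕ → ↥(algA K (ℕ →₀ K))
  | 0 => ⟨!![1, 0; 0, 0], by simpa using ite_mem_evenPart K True, by simp⟩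
  | 1 => ⟨!![0, 1; 0, 0], by simp, by simp⟩
  | j + 2 => genMat K j

theorem genMat_zero_sq : genMat K 0 * genMat K 0 = substMat K 0 := by
  apply Subtype.ext
  simp [genMat, substMat, gen_mul_self]

theorem substMat_zero_mul_genMat_one : substMat K 0 * genMat K 1 = substMat K 1 := by
  apply Subtype.ext
  ext i j
  fin_cases i <;> fin_cases j <;> simp [genMat, substMat]

theorem entryUL_substMat (j : ℕ) :
    entryUL K _ (substMat K j) = algebraMap K _ (if j = 0 ∨ j = 2 then 1 else 0) := by
  rcases j with _ | _ | j <;> simp [entryUL_apply, substMat, genMat]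

theorem entryLR_substMat (j : ℕ) :
    entryLR K _ (substMat K j) = if j < 2 then 0 else gen K j := by
  rcases j with _ | _ | j <;> simp [entryLR_apply, substMat, genMat]

theorem br_entryLR_substMat (i j : ℕ) :
    br (entryLR K _ (substMat K i)) (entryLR K _ (substMat K j)) =
      2 * (entryLR K _ (substMat K i) * entryLR K _ (substMat K j)) := by
  rw [entryLR_substMat, entryLR_substMat]
  split_ifs <;> simp [br, ← br_gen]

theorem entryUL_commPow_br (i j k : ℕ) :
    entryUL K _ (commPow (br (substMat K i) (substMat K j)) (substMat K 0) k) = 0 := by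
  rw [map_commPow, map_br, entryUL_substMat, entryUL_substMat, br, ← map_mul, ← map_mul, mul_comm,
    sub_self, commPow_zero_left]

theorem br_substMat_zero_one : br (substMat K 0) (substMat K 1) = substMat K 1 := by
  apply Subtype.ext
  ext i j
  fin_cases i <;> fin_cases j <;> simp [br, substMat]

theorem br_substMat_one_zero : br (substMat K 1) (substMat K 0) = -substMat K 1 := by
  apply Subtype.ext
  ext i j
  fin_cases i <;> fin_cases j <;> simp [br, substMat]

theorem entryUR_commPow_substMat_one (k : ℕ) :
    entryUR K _ (commPow (substMat K 1) (substMat K 0) k) = (-1) ^ k := by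
  induction k with
  | zero => simp [commPow, entryUR_apply, substMat]
  | succ k ih =>
    have h : commPow (substMat K 1) (substMat K 0) (k + 1) =
        commPow (br (substMat K 1) (substMat K 0)) (substMat K 0) k :=
      Function.iterate_succ_apply _ _ _
    rw [h, br_substMat_one_zero, commPow_neg, map_neg, ih, pow_succ, mul_neg_one]

theorem gen_mul_entryUR_commPow (i j k : ℕ) (hi : i < 2) (hj : j < 2) (hij : i ≠ j) :
    gen K 0 * gen K 1 *
        entryUR K _ (commPow (br (substMat K i) (substMat K j)) (substMat K 0) k) =
      (-1) ^ k * (gen K i * gen K j) := by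
  have hc : ∀ x : Einf K, x * (-1) ^ k = (-1) ^ k * x := fun x =>
    ((Commute.neg_one_left x).pow_left k).eq.symm
  obtain ⟨rfl, rfl⟩ | ⟨rfl, rfl⟩ : (i = 0 ∧ j = 1) ∨ (i = 1 ∧ j = 0) := by omega
  · rw [br_substMat_zero_one, entryUR_commPow_substMat_one, hc]
  · rw [br_substMat_one_zero, commPow_neg, map_neg, entryUR_commPow_substMat_one,
      mul_neg, hc, gen_mul_gen_swap K 1 0, mul_neg]

end

theorem prod_range_pairs {R : Type} [Monoid R] (g : ℕ → R) (h : ℕ) :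
    ((List.range h).map fun i => g (2 * i) * g (2 * i + 1)).prod =
      ((List.range (2 * h)).map g).prod := by
  induction h with
  | zero => simp
  | succ h ih =>
    rw [List.prod_range_succ, ih, show 2 * (h + 1) = 2 * h + 1 + 1 by ring, List.prod_range_succ,
      List.prod_range_succ, mul_assoc]

theorem prod_two_mul {R : Type} [Ring R] (g : ℕ → R) (h : ℕ) :
    ((List.range h).map fun i => 2 * g i).prod = 2 ^ h * ((List.range h).map g).prod := by
  induction h with
  | zero => simp
  | succ h ih =>
    rw [List.prod_range_succ, ih, List.prod_range_succ, pow_succ]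
    have := Nat.cast_comm 2 ((List.range h).map g).prod
    push_cast at this
    simp only [mul_assoc]
    rw [← mul_assoc _ 2, ← this]
    simp only [mul_assoc]

theorem ofFn_eq_range_map {R : Type} (g : ℕ → R) (h : ℕ) :
    (List.ofFn fun i : Fin h => g i) = (List.range h).map g := by
  rw [List.ofFn_eq_map, ← List.map_coe_finRange_eq_range, List.map_map]
  rfl

section

variable (K : Type) [Field K]

theorem lt_two_of_forall_two_le {n : ℕ} (σ : Equiv.Perm (Fin (n + 2)))
    (h : ∀ j (hj : j < n), 2 ≤ (σ ⟨j + 2, by omega⟩ : ℕ)) : (σ 0 : ℕ) < 2 ∧ (σ 1 : ℕ) < 2 := by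
  have key : ∀ t : Fin (n + 2), (t : ℕ) < 2 → (σ.symm t : ℕ) < 2 := by
    intro t ht
    by_contra hc
    have h1 := h ((σ.symm t : ℕ) - 2) (by omega)
    have h2 : (⟨(σ.symm t : ℕ) - 2 + 2, by omega⟩ : Fin (n + 2)) = σ.symm t :=
      Fin.ext (by simp only []; omega)
    rw [h2, Equiv.apply_symm_apply] at h1
    omega
  have h0 := key 0 (by simp)
  have h1 := key 1 (by simp)
  have hne : (σ.symm 0 : ℕ) ≠ σ.symm 1 := fun hc => by
    simpa using σ.symm.injective (Fin.ext hc)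
  obtain ⟨ha, hb⟩ | ⟨ha, hb⟩ : ((σ.symm 0 : ℕ) = 0 ∧ (σ.symm 1 : ℕ) = 1) ∨
      ((σ.symm 0 : ℕ) = 1 ∧ (σ.symm 1 : ℕ) = 0) := by omega
  · have h2 : σ.symm 0 = 0 := Fin.ext ha
    have h3 : σ.symm 1 = 1 := Fin.ext (by simpa using hb)
    rw [Equiv.symm_apply_eq] at h2 h3
    rw [← h2, ← h3]
    simp
  · have h2 : σ.symm 0 = 1 := Fin.ext (by simpa using ha)
    have h3 : σ.symm 1 = 0 := Fin.ext hb
    rw [Equiv.symm_apply_eq] at h2 h3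
    rw [← h2, ← h3]
    simp

theorem two_le_of_lt_two {n : ℕ} (σ : Equiv.Perm (Fin (n + 2)))
    (h0 : (σ 0 : ℕ) < 2) (h1 : (σ 1 : ℕ) < 2) (j : ℕ) (hj : j < n) :
    2 ≤ (σ ⟨j + 2, by omega⟩ : ℕ) := by
  have e01 : (σ 0 : ℕ) ≠ σ 1 := fun hc => by simpa using σ.injective (Fin.ext hc)
  have e0 : (σ 0 : ℕ) ≠ σ ⟨j + 2, by omega⟩ := fun hc => by
    simpa [Fin.ext_iff] using σ.injective (Fin.ext hc)
  have e1 : (σ 1 : ℕ) ≠ σ ⟨j + 2, by omega⟩ := fun hc => by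
    simpa [Fin.ext_iff] using σ.injective (Fin.ext hc)
  omega

/-- The product of commutators occurring in `f⁽⁵⁾`, evaluated at `y`. -/
def commProd {R : Type} [Ring R] (y : ℕ → R) (n k : ℕ) (σ : Equiv.Perm (Fin (n + 2))) : R :=
  commPow (br (y (σ 0)) (y (σ 1))) (y 0) k *
    (List.ofFn fun i : Fin (n / 2) =>
      br (y (σ ⟨2 * i.1 + 2, by have := i.2; omega⟩))
        (y (σ ⟨2 * i.1 + 3, by have := i.2; omega⟩))).prod

theorem entryLR_prod_br {n : ℕ} (hne : Even n) (σ : Equiv.Perm (Fin (n + 2))) :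
    entryLR K _ (List.ofFn fun i : Fin (n / 2) =>
      br (substMat K (σ ⟨2 * i.1 + 2, by have := i.2; omega⟩))
        (substMat K (σ ⟨2 * i.1 + 3, by have := i.2; omega⟩))).prod =
      2 ^ (n / 2) *
        (List.ofFn fun i : Fin n => entryLR K _ (substMat K (σ ⟨i + 2, by omega⟩))).prod := by
  let g : ℕ → Einf K := fun j =>
    if hj : j < n then entryLR K _ (substMat K (σ ⟨j + 2, by omega⟩)) else 0
  have hg : ∀ j (hj : j < n), g j = entryLR K _ (substMat K (σ ⟨j + 2, by omega⟩)) :=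
    fun j hj => dif_pos hj
  rw [map_list_prod, List.map_ofFn]
  have h1 : (⇑(entryLR K (ℕ →₀ K)) ∘ fun i : Fin (n / 2) =>
      br (substMat K (σ ⟨2 * i.1 + 2, by have := i.2; omega⟩))
        (substMat K (σ ⟨2 * i.1 + 3, by have := i.2; omega⟩))) =
      fun i : Fin (n / 2) => 2 * (g (2 * i) * g (2 * i + 1)) := by
    funext i
    have := i.2
    rw [Function.comp_apply, map_br, br_entryLR_substMat, hg _ (by omega), hg _ (by omega)]
  have h2 : (fun i : Fin n => entryLR K _ (substMat K (σ ⟨i + 2, by omega⟩))) =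
      fun i : Fin n => g i := funext fun i => (hg i i.2).symm
  rw [h1, h2, ofFn_eq_range_map (fun i => 2 * (g (2 * i) * g (2 * i + 1))), ofFn_eq_range_map,
    prod_two_mul (fun i => g (2 * i) * g (2 * i + 1)), prod_range_pairs,
    Nat.two_mul_div_two_of_even hne]

theorem entryUR_commProd {n : ℕ} (hne : Even n) (k : ℕ) (σ : Equiv.Perm (Fin (n + 2))) :
    gen K 0 * gen K 1 * entryUR K _ (commProd (substMat K) n k σ) =
      (if (σ 0 : ℕ) < 2 ∧ (σ 1 : ℕ) < 2 then (-1) ^ k * 2 ^ (n / 2) else 0 : K) •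
        ExteriorAlgebra.ιMulti K (n + 2) fun i => Finsupp.single (σ i : ℕ) 1 := by
  rw [commProd, entryUR_mul, entryUL_commPow_br, zero_mul, zero_add, entryLR_prod_br K hne]
  split_ifs with h
  · have h1 : (fun i : Fin n => entryLR K _ (substMat K (σ ⟨i + 2, by omega⟩))) =
        fun i : Fin n => gen K (σ i.succ.succ) := funext fun i => by
      rw [entryLR_substMat, if_neg (two_le_of_lt_two σ h.1 h.2 i i.2).not_gt]
      rfl
    have hne01 : (σ 0 : ℕ) ≠ σ 1 := fun hc => by simpa using σ.injective (Fin.ext hc)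
    have h2 : ((-1) ^ k * 2 ^ (n / 2) : Einf K) =
        algebraMap K _ ((-1) ^ k * 2 ^ (n / 2)) := by
      rw [map_mul, map_pow, map_pow, map_neg, map_one, map_ofNat]
    rw [h1, ← mul_assoc, gen_mul_entryUR_commPow K _ _ k h.1 h.2 hne01, Algebra.smul_def, ← h2,
      ExteriorAlgebra.ιMulti_apply, List.ofFn_succ, List.ofFn_succ, List.prod_cons, List.prod_cons]
    have h3 : ∀ x : Einf K, x * 2 ^ (n / 2) = 2 ^ (n / 2) * x := fun x =>
      ((Commute.ofNat_left 2 x).pow_left _).eq.symm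
    rw [mul_assoc ((-1) ^ k), mul_assoc ((-1) ^ k), ← mul_assoc (_ * _) (2 ^ (n / 2)), h3]
    simp only [mul_assoc]
    rfl
  · rw [zero_smul]
    have h1 : ∃ i : Fin n, (σ ⟨i + 2, by omega⟩ : ℕ) < 2 := by
      by_contra! hc
      exact h (lt_two_of_forall_two_le σ fun j hj => hc ⟨j, hj⟩)
    obtain ⟨i, hi⟩ := h1
    rw [List.prod_eq_zero (List.mem_ofFn.2 ⟨i, by rw [entryLR_substMat, if_pos hi]⟩), mul_zero,
      mul_zero, mul_zero]

theorem sum_commProd_ne_zero [CharZero K] {n : ℕ} (hne : Even n) (k : ℕ) :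
    ∑ σ : Equiv.Perm (Fin (n + 2)),
      (Equiv.Perm.sign σ : ℤ) • commProd (substMat K) n k σ ≠ 0 := by
  intro h
  set ω := ExteriorAlgebra.ιMulti K (n + 2)
    fun i : Fin (n + 2) => (Finsupp.single (i : ℕ) 1 : ℕ →₀ K)
  have hσ : ∀ σ : Equiv.Perm (Fin (n + 2)),
      (ExteriorAlgebra.ιMulti K (n + 2) fun i => (Finsupp.single (σ i : ℕ) 1 : ℕ →₀ K)) =
        (Equiv.Perm.sign σ : ℤ) • ω := fun σ =>
    (ExteriorAlgebra.ιMulti K (n + 2)).map_perm (fun i => Finsupp.single (i : ℕ) 1) σ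
  have h1 := congrArg (fun M => gen K 0 * gen K 1 * entryUR K _ M) h
  simp only [map_sum, map_zsmul, map_zero, mul_zero, Finset.mul_sum, mul_smul_comm,
    entryUR_commProd K hne, hσ] at h1
  have h2 : ∀ σ : Equiv.Perm (Fin (n + 2)), ∀ c : K,
      (Equiv.Perm.sign σ : ℤ) • c • (Equiv.Perm.sign σ : ℤ) • ω = c • ω := fun σ c => by
    rw [smul_comm c, smul_smul, ← Units.val_mul, Int.units_mul_self, Units.val_one, one_smul]
  simp only [h2] at h1
  rw [← Finset.sum_smul, smul_eq_zero, ← Finset.sum_filter, Finset.sum_const, nsmul_eq_mul] at h1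
  refine h1.elim (fun hc => ?_) (ιMulti_single_ne_zero K (n + 2))
  have h3 : (1 : Equiv.Perm (Fin (n + 2))) ∈
      Finset.univ.filter fun σ : Equiv.Perm (Fin (n + 2)) => (σ 0 : ℕ) < 2 ∧ (σ 1 : ℕ) < 2 := by
    simp
  exact mul_ne_zero (Nat.cast_ne_zero.2 (Finset.card_ne_zero_of_mem h3))
    (mul_ne_zero (pow_ne_zero _ (neg_ne_zero.2 one_ne_zero)) (pow_ne_zero _ two_ne_zero)) hc

/-- The elements `x₁², x₁²x₂, x₁, …, xₙ` of the free algebra of rank `n`, listed as a sequence. -/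
noncomputable def substFree (n : ℕ) [NeZero n] : ℕ → FreeAlgebra K (Fin n)
  | 0 => FreeAlgebra.ι K 0 * FreeAlgebra.ι K 0
  | 1 => FreeAlgebra.ι K 0 * FreeAlgebra.ι K 0 * FreeAlgebra.ι K (Fin.ofNat n 1)
  | j + 2 => FreeAlgebra.ι K (Fin.ofNat n j)

theorem lift_substFree {n : ℕ} [NeZero n] (hn : 2 ≤ n) (j : ℕ) (hj : j < n + 2) :
    FreeAlgebra.lift K (fun i : Fin n => genMat K i) (substFree K n j) = substMat K j := by
  rcases j with _ | _ | j
  · simp [substFree, genMat_zero_sq]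
  · simp [substFree, genMat_zero_sq, Nat.mod_eq_of_lt (show 1 < n by omega),
      substMat_zero_mul_genMat_one]
  · simp [substFree, substMat, Nat.mod_eq_of_lt (show j < n by omega)]

end

/-- Any substitution in the relatively free algebra by images of `g`, followed by a homomorphism
`ψ` to `R`, is a substitution in `R`. -/
theorem IsPI.lift_comp {K : Type} [Field K] {R : Type} [Ring R] [Algebra K R] {n : ℕ}
    {X : Type} {f : FreeAlgebra K X} (hf : IsPI K (RelFree K R n) f)
    (ψ : FreeAlgebra K (Fin n) →ₐ[K] R) (g : X → FreeAlgebra K (Fin n)) :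
    FreeAlgebra.lift K (fun x => ψ (g x)) f = 0 := by
  let q : RelFree K R n →ₐ[K] R := RingQuot.liftAlgHom K
    ⟨ψ, fun a b h => sub_eq_zero.1 ((map_sub ψ a b).symm.trans (h ψ))⟩
  have h : FreeAlgebra.lift K (fun x => ψ (g x)) =
      q.comp (FreeAlgebra.lift K fun x => RingQuot.mkAlgHom K _ (g x)) := by
    ext x
    simp [q]
  rw [h, AlgHom.comp_apply, hf, map_zero]

/-- For even `n ≥ 2` and `m ≥ n + 2`, the polynomial
`f⁽⁵⁾_{m,n+2} = Σ_{σ ∈ S_{n+2}} sgn(σ)·[x_{σ(1)},x_{σ(2)},x₁,…,x₁][x_{σ(3)},x_{σ(4)}]⋯[x_{σ(n+1)},x_{σ(n+2)}]`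
(with `m - n - 2` occurrences of `x₁` after `x_{σ(2)}`) is not a polynomial identity of
`F_n(A)`. -/
theorem f5_not_identity_of_relfree (K : Type) [Field K] [CharZero K]
    (n m : ℕ) (hn : 2 ≤ n) (hne : Even n) (hm : n + 2 ≤ m) :
    ¬ IsPI K (RelFree K (↥(algA K (ℕ →₀ K))) n)
        (∑ σ : Equiv.Perm (Fin (n + 2)), (Equiv.Perm.sign σ : ℤ) •
          (commPow (br (xv K ((σ 0 : ℕ) + 1)) (xv K ((σ 1 : ℕ) + 1))) (xv K 1) (m - n - 2) *
            (List.ofFn fun i : Fin (n / 2) =>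
              br (xv K ((σ ⟨2 * i.1 + 2, by have := i.2; omega⟩ : ℕ) + 1))
                 (xv K ((σ ⟨2 * i.1 + 3, by have := i.2; omega⟩ : ℕ) + 1))).prod)) := by
  intro h
  have : NeZero n := ⟨by omega⟩
  have h0 := h.lift_comp (FreeAlgebra.lift K fun i : Fin n => genMat K i)
    fun j => substFree K n (j - 1)
  refine sum_commProd_ne_zero K hne (m - n - 2) ?_
  rw [← h0, map_sum]
  refine Finset.sum_congr rfl fun σ _ => ?_
  have hx : ∀ j : Fin (n + 2), FreeAlgebra.lift K
      (fun j => FreeAlgebra.lift K (fun i : Fin n => genMat K i) (substFree K n (j - 1)))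
      (xv K ((j : ℕ) + 1)) = substMat K j := fun j => by
    rw [xv, FreeAlgebra.lift_ι_apply, Nat.add_sub_cancel, lift_substFree K hn j j.2]
  have hx0 := hx 0
  rw [Fin.val_zero, zero_add] at hx0
  set Θ := FreeAlgebra.lift K
    fun j => FreeAlgebra.lift K (fun i : Fin n => genMat K i) (substFree K n (j - 1))
  have hbr : ∀ a b, Θ (br a b) = br (Θ a) (Θ b) := map_br Θ.toRingHom
  have hcomm : ∀ a b k, Θ (commPow a b k) = commPow (Θ a) (Θ b) k := map_commPow Θ.toRingHom
  rw [map_zsmul, map_mul, hcomm, hbr, map_list_prod, List.map_ofFn, hx, hx, hx0, commProd]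
  simp only [Function.comp_def, hbr, hx]
end

section
/- For every even integer n ≥ 2, the polynomial [x₁,x₂][x₃,x₄]⋯[x_{n+3},x_{n+4}] (a product of (n+4)/2 commutators in n+4 distinct variables) is a polynomial identity of the finite-dimensional algebra A^{(n)}. -/
/-- The part of the exterior algebra of degree at least `m`. -/
def gradeGE (K V : Type) [Field K] [AddCommGroup V] [Module K V] (m : ℕ) :
    Submodule K (ExteriorAlgebra K V) :=
  ⨆ i : ℕ, LinearMap.range (ExteriorAlgebra.ι K : V →ₗ[K] ExteriorAlgebra K V) ^ (m + i)

section exteriorAlgebra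

variable {K V : Type} [Field K] [AddCommGroup V] [Module K V]

theorem gradeGE_mul_mem {p q : ℕ} {a b : ExteriorAlgebra K V}
    (ha : a ∈ gradeGE K V p) (hb : b ∈ gradeGE K V q) : a * b ∈ gradeGE K V (p + q) := by
  have h : gradeGE K V p * gradeGE K V q ≤ gradeGE K V (p + q) := by
    unfold gradeGE
    rw [Submodule.iSup_mul]
    refine iSup_le fun i => ?_
    rw [Submodule.mul_iSup]
    refine iSup_le fun j => ?_
    rw [← pow_add, show p + i + (q + j) = p + q + (i + j) by ring]
    exact le_iSup (fun i => LinearMap.range (ExteriorAlgebra.ι K : V →ₗ[K] _) ^ (p + q + i)) (i + j)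
  exact h (Submodule.mul_mem_mul ha hb)

theorem gradeGE_zero : gradeGE K V 0 = ⊤ := by
  have h := (DirectSum.Decomposition.isInternal
    (fun i : ℕ => ExteriorAlgebra.exteriorPower K i V)).submodule_iSup_eq_top
  simpa only [gradeGE, zero_add] using h

theorem exists_algebraMap_add_gradeGE_one (a : ExteriorAlgebra K V) :
    ∃ c : K, ∃ b ∈ gradeGE K V 1, a = algebraMap K _ c + b := by
  have h : (⊤ : Submodule K (ExteriorAlgebra K V)) ≤ 1 ⊔ gradeGE K V 1 := by
    rw [← gradeGE_zero]
    refine iSup_le fun i => ?_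
    rcases i with _ | i
    · simp
    · refine le_sup_of_le_right ?_
      rw [show 0 + (i + 1) = 1 + i by ring]
      exact le_iSup (fun i => LinearMap.range (ExteriorAlgebra.ι K : V →ₗ[K] _) ^ (1 + i)) i
  obtain ⟨y, hy, z, hz, rfl⟩ := Submodule.mem_sup.1 (h (Submodule.mem_top (x := a)))
  obtain ⟨c, rfl⟩ := Submodule.mem_one.1 hy
  exact ⟨c, z, hz, rfl⟩

theorem br_algebraMap_add {R : Type} [Ring R] [Algebra K R] (c d : K) (a b : R) :
    br (algebraMap K R c + a) (algebraMap K R d + b) = br a b := by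
  simp only [br, add_mul, mul_add, Algebra.commutes c b, Algebra.commutes d a,
    Algebra.commutes c (algebraMap K R d)]
  abel

theorem br_mem_gradeGE_two (a b : ExteriorAlgebra K V) : br a b ∈ gradeGE K V 2 := by
  obtain ⟨c, a, ha, rfl⟩ := exists_algebraMap_add_gradeGE_one a
  obtain ⟨d, b, hb, rfl⟩ := exists_algebraMap_add_gradeGE_one b
  rw [br_algebraMap_add]
  exact Submodule.sub_mem _ (gradeGE_mul_mem (p := 1) (q := 1) ha hb)
    (gradeGE_mul_mem (p := 1) (q := 1) hb ha)

theorem gradeGE_eq_bot [FiniteDimensional K V] {m : ℕ} (hm : Module.finrank K V < m) :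
    gradeGE K V m = ⊥ := by
  refine eq_bot_iff.2 (iSup_le fun i => ?_)
  change ExteriorAlgebra.exteriorPower K (m + i) V ≤ ⊥
  rw [← ExteriorAlgebra.ιMulti_span_fixedDegree, Submodule.span_le]
  rintro _ ⟨v, rfl⟩
  refine AlternatingMap.map_linearDependent _ v fun hv => ?_
  have := hv.fintype_card_le_finrank
  rw [Fintype.card_fin] at this
  omega

theorem commute_ι_mul_ι (v w : V) (y : ExteriorAlgebra K V) :
    Commute (ExteriorAlgebra.ι K v * ExteriorAlgebra.ι K w) y := by
  have anti (v w : V) : ExteriorAlgebra.ι K v * ExteriorAlgebra.ι K w =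
      -(ExteriorAlgebra.ι K w * ExteriorAlgebra.ι K v) :=
    eq_neg_of_add_eq_zero_left (ExteriorAlgebra.ι_add_mul_swap v w)
  induction y using ExteriorAlgebra.induction with
  | algebraMap r => exact Algebra.commute_algebraMap_right r _
  | ι u =>
    rw [commute_iff_eq, mul_assoc, anti w u, mul_neg, ← mul_assoc, anti v u, neg_mul, neg_neg,
      mul_assoc]
  | mul a b ha hb => exact ha.mul_right hb
  | add a b ha hb => exact ha.add_right hb

theorem commute_of_mem_evenPart {x : ExteriorAlgebra K V} (hx : x ∈ evenPart K V)
    (y : ExteriorAlgebra K V) : Commute x y := by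
  induction x, hx using CliffordAlgebra.even_induction with
  | algebraMap r => exact Algebra.commute_algebraMap_left r y
  | add a b _ _ ha hb => exact ha.add_left hb
  | ι_mul_ι_mul v w x _ hx => exact (commute_ι_mul_ι v w y).mul_left hx

end exteriorAlgebra

section chain

variable {K V : Type} [Field K] [AddCommGroup V] [Module K V]

theorem algA_br_entries (a b : algA K V) :
    (br a b).1 0 0 = 0 ∧ (br a b).1 1 1 ∈ gradeGE K V 2 := by
  obtain ⟨a, ha0, ha1⟩ := a
  obtain ⟨b, hb0, hb1⟩ := b
  constructor
  · simpa [br, Matrix.mul_apply, Fin.sum_univ_two, ha1, hb1, sub_eq_zero] using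
      (commute_of_mem_evenPart ha0 (b 0 0)).eq
  · simpa [br, Matrix.mul_apply, Fin.sum_univ_two, ha1, hb1] using
      br_mem_gradeGE_two (a 1 1) (b 1 1)

theorem algA_prod_entries (c : ℕ → algA K V)
    (hc : ∀ i, (c i).1 0 0 = 0 ∧ (c i).1 1 1 ∈ gradeGE K V 2) (k : ℕ) :
    (((List.range (k + 1)).map c).prod).1 0 0 = 0 ∧
      (((List.range (k + 1)).map c).prod).1 0 1 ∈ gradeGE K V (2 * k) ∧
      (((List.range (k + 1)).map c).prod).1 1 1 ∈ gradeGE K V (2 * (k + 1)) := by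
  induction k with
  | zero =>
    refine ⟨by simpa using (hc 0).1, ?_, by simpa using (hc 0).2⟩
    rw [mul_zero, gradeGE_zero]
    trivial
  | succ k ih =>
    rw [List.range_succ, List.map_append, List.prod_append, List.map_singleton,
      List.prod_singleton]
    generalize ((List.range (k + 1)).map c).prod = M at ih
    obtain ⟨h00, h01, h11⟩ := ih
    obtain ⟨c0, c1⟩ := hc (k + 1)
    have c10 : (c (k + 1)).1 1 0 = 0 := (c (k + 1)).2.2
    have M10 : M.1 1 0 = 0 := M.2.2
    rw [MulMemClass.coe_mul]
    simp only [Matrix.mul_apply, Fin.sum_univ_two, h00, c10, M10, zero_mul, mul_zero, zero_add,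
      true_and]
    exact ⟨gradeGE_mul_mem h01 c1, gradeGE_mul_mem h11 c1⟩

end chain

/-- For even `n ≥ 2`, the polynomial `[x₁,x₂][x₃,x₄]⋯[x_{n+3},x_{n+4}]`
is a polynomial identity of the finite-dimensional algebra `A⁽ⁿ⁾`. -/
theorem chain_is_identity_of_algA_fin (K : Type) [Field K] [CharZero K]
    (n : ℕ) (hn : 2 ≤ n) (hne : Even n) :
    IsPI K (↥(algA K (Fin n → K))) (chainProd K ((n + 4) / 2)) := by
  intro φ
  obtain ⟨m, rfl⟩ := hne
  rw [show (m + m + 4) / 2 = (m + 1) + 1 by omega, chainProd, map_list_prod, List.map_map]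
  obtain ⟨h00, h01, h11⟩ := algA_prod_entries
    (φ ∘ fun i => br (xv K (2 * i + 1)) (xv K (2 * i + 2)))
    (fun i => by
      have h : φ (br (xv K (2 * i + 1)) (xv K (2 * i + 2))) =
          br (φ (xv K (2 * i + 1))) (φ (xv K (2 * i + 2))) := by simp [br]
      rw [Function.comp_apply, h]
      exact algA_br_entries _ _) (m + 1)
  rw [gradeGE_eq_bot (by rw [Module.finrank_fin_fun]; omega), Submodule.mem_bot] at h01 h11
  refine Subtype.ext (Matrix.ext fun i j => ?_)
  fin_cases i <;> fin_cases j
  · exact h00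
  · exact h01
  · exact Subtype.property (p := (· ∈ algA K (Fin (m + m) → K))) _ |>.2
  · exact h11
end
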